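/- (Greenberg) Let i ≥ 0 and let F be a C_i field. Then the field F((t)) of formal Laurent series over F is a C_{i+1} field. -/

import Mathlib

/-- A field `K` is a `C_i` field if every homogeneous polynomial over `K` of degree `d ≥ 1`
in `n` variables with `n > d ^ i` has a nontrivial zero in `Kⁿ`. -/
def IsCField (i : ℕ) (K : Type*) [Field K] : Prop :=
  ∀ (n d : ℕ), 1 ≤ d → d ^ i < n → ∀ φ : MvPolynomial (Fin n) K,
    φ.IsHomogeneous d → ∃ x : Fin n → K, x ≠ 0 ∧ MvPolynomial.eval x φ = 0

section Forms

open MvPolynomial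

lemma eval_aeval_eq {σ τ A : Type*} [CommSemiring A] (g : σ → MvPolynomial τ A)
    (φ : MvPolynomial σ A) (x : τ → A) :
    eval x (aeval g φ) = eval (fun j => eval x (g j)) φ := by
  induction φ using MvPolynomial.induction_on <;> simp_all

lemma aeval_const_mul_of_isHomogeneous {σ A S : Type*} [CommSemiring A] [CommSemiring S]
    [Algebra A S] {φ : MvPolynomial σ A} {d : ℕ} (hφ : φ.IsHomogeneous d) (c : S) (x : σ → S) :
    aeval (fun j => c * x j) φ = c ^ d * aeval x φ := by
  rw [aeval_def, aeval_def, eval₂_eq, eval₂_eq, Finset.mul_sum]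
  refine Finset.sum_congr rfl fun m hm => ?_
  have hdeg : ∑ j ∈ m.support, m j = d := by
    have := hφ (mem_support_iff.1 hm)
    rwa [Pi.one_def, ← Finsupp.degree_eq_weight_one] at this
  simp only [mul_pow, Finset.prod_mul_distrib, Finset.prod_pow_eq_pow_sum, hdeg]
  ring

lemma eval_const_mul_of_isHomogeneous {σ A : Type*} [CommSemiring A] {φ : MvPolynomial σ A} {d : ℕ}
    (hφ : φ.IsHomogeneous d) (c : A) (x : σ → A) :
    eval (fun j => c * x j) φ = c ^ d * eval x φ := by
  exact aeval_const_mul_of_isHomogeneous hφ c x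

/-- There is a form of degree `D` in `N` variables over `F` with only the trivial zero. -/
def ExistsAnisotropicForm (F : Type*) [Field F] (N D : ℕ) : Prop :=
  ∃ φ : MvPolynomial (Fin N) F, φ.IsHomogeneous D ∧ ∀ x, eval x φ = 0 → x = 0

variable {F : Type*} [Field F]

lemma ExistsAnisotropicForm.of_form {σ : Type*} [Fintype σ] {D : ℕ} {φ : MvPolynomial σ F}
    (hφ : φ.IsHomogeneous D) (h : ∀ x, eval x φ = 0 → x = 0) {N : ℕ} (hN : Fintype.card σ = N) :
    ExistsAnisotropicForm F N D := by
  subst hN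
  let e := Fintype.equivFin σ
  refine ⟨rename e φ, hφ.rename_isHomogeneous, fun x hx => ?_⟩
  rw [eval_rename] at hx
  have := h _ hx
  funext j
  simpa using congrFun this (e.symm j)

lemma ExistsAnisotropicForm.mono {N N' D : ℕ} (h : ExistsAnisotropicForm F N D) (hN : N' ≤ N) :
    ExistsAnisotropicForm F N' D := by
  obtain ⟨φ, hφ, h0⟩ := h
  have hg : Function.Injective (Fin.castLE hN) := Fin.castLE_injective hN
  let g : Fin N → MvPolynomial (Fin N') F := Function.extend (Fin.castLE hN) X 0
  have hgj : ∀ j, (g j).IsHomogeneous 1 := by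
    intro j
    by_cases hj : ∃ k, Fin.castLE hN k = j
    · obtain ⟨k, rfl⟩ := hj
      simp only [g, hg.extend_apply]
      exact isHomogeneous_X _ _
    · simp only [g, Function.extend_apply' _ _ _ hj, Pi.zero_apply]
      exact isHomogeneous_zero _ _ _
  refine ⟨aeval g φ, by simpa using hφ.aeval g hgj, fun x hx => ?_⟩
  rw [eval_aeval_eq] at hx
  have := h0 _ hx
  funext k
  have h2 := congrFun this (Fin.castLE hN k)
  simpa [g, hg.extend_apply] using h2

lemma ExistsAnisotropicForm.comp {r n m d D : ℕ} {f : Fin r → MvPolynomial (Fin n) F}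
    (hf : ∀ j, (f j).IsHomogeneous d) (hf0 : ∀ x, (∀ j, eval x (f j) = 0) → x = 0)
    (h : ExistsAnisotropicForm F (r * m) D) : ExistsAnisotropicForm F (n * m) (d * D) := by
  obtain ⟨φ, hφ, h0⟩ := h
  let g : Fin (r * m) → MvPolynomial (Fin n × Fin m) F := fun j =>
    rename (fun s => (s, (finProdFinEquiv.symm j).2)) (f (finProdFinEquiv.symm j).1)
  refine ExistsAnisotropicForm.of_form (φ := aeval g φ)
    (hφ.aeval g fun j => (hf _).rename_isHomogeneous) (fun x hx => ?_) (by simp)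
  rw [eval_aeval_eq] at hx
  have := h0 _ hx
  funext ⟨s, b⟩
  refine congrFun (hf0 (fun s => x (s, b)) fun j => ?_) s
  have h2 := congrFun this (finProdFinEquiv (j, b))
  simpa only [g, eval_rename, Function.comp_def, Equiv.symm_apply_apply, Pi.zero_apply] using h2

lemma IsCField.le_of_existsAnisotropicForm {i : ℕ} (hF : IsCField i F) {N D : ℕ} (hD : 1 ≤ D)
    (h : ExistsAnisotropicForm F N D) : N ≤ D ^ i := by
  by_contra! hlt
  obtain ⟨φ, hφ, h0⟩ := h
  obtain ⟨x, hx, hx0⟩ := hF N D hD hlt φ hφ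
  exact hx (h0 x hx0)

lemma exists_existsAnisotropicForm_two (h : ¬ IsAlgClosed F) :
    ∃ e, 1 ≤ e ∧ ExistsAnisotropicForm F 2 e := by
  obtain ⟨p, hp, hirr, hroot⟩ : ∃ p : Polynomial F, p.Monic ∧ Irreducible p ∧
      ∀ x, p.eval x ≠ 0 := by
    by_contra! hc
    exact h (IsAlgClosed.of_exists_root F hc)
  refine ⟨p.natDegree, hirr.natDegree_pos, p.homogenize p.natDegree,
    Polynomial.isHomogeneous_homogenize p, fun x hx => ?_⟩
  have h1 : x 1 = 0 := by
    by_contra h1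
    refine hroot (x 0 / x 1) ?_
    have h2 := Polynomial.eval₂_homogenize_of_eq_one (p := p) le_rfl (RingHom.id F)
      (fun j => (x 1)⁻¹ * x j) (by simp [h1])
    change eval (fun j => (x 1)⁻¹ * x j) _ = _ at h2
    rw [eval_const_mul_of_isHomogeneous (Polynomial.isHomogeneous_homogenize p), hx] at h2
    simpa [div_eq_inv_mul, Polynomial.eval₂_id] using h2.symm
  have h0 : x 0 = 0 := by
    simp only [Polynomial.homogenize, map_sum, eval_monomial] at hx
    rw [Finset.sum_eq_single (p.natDegree, 0)] at hx
    · simpa [h1, hp.leadingCoeff, Finsupp.prod_fintype, hirr.natDegree_pos.ne'] using hx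
    · rintro ⟨a, b⟩ hab hne
      have hb : b ≠ 0 := by
        rintro rfl
        simp_all
      simp [Finsupp.prod_fintype, h1, hb]
    · simp
  funext j
  fin_cases j <;> simp [h0, h1]

lemma exists_existsAnisotropicForm_two_pow (h : ¬ IsAlgClosed F) (k : ℕ) :
    ∃ D, 1 ≤ D ∧ ExistsAnisotropicForm F (2 ^ k) D := by
  obtain ⟨e, he, hφ⟩ := exists_existsAnisotropicForm_two h
  induction k with
  | zero =>
    refine ⟨1, le_rfl, X 0, isHomogeneous_X _ _, fun x hx => ?_⟩
    funext j
    obtain rfl : j = 0 := Fin.ext (by have := j.2; simp at this ⊢)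
    simpa using hx
  | succ k ih =>
    obtain ⟨D, hD, ψ, hψ, hψ0⟩ := ih
    exact ⟨D * e, Nat.mul_pos hD he, ExistsAnisotropicForm.comp (r := 1) (m := 2)
      (f := fun _ => ψ) (fun _ => hψ) (fun x hx => hψ0 x (hx 0)) hφ⟩

/-- Lang and Nagata: iterating the substitution of an anisotropic system into forms of growing
degree violates the `C_i` bound. -/
lemma IsCField.exists_common_zero_of_not_isAlgClosed {i : ℕ} (hF : IsCField i F)
    (hcl : ¬ IsAlgClosed F) {r n d : ℕ} (hd : 1 ≤ d) (hn : r * d ^ i < n)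
    (f : Fin r → MvPolynomial (Fin n) F) (hf : ∀ j, (f j).IsHomogeneous d) :
    ∃ x, x ≠ 0 ∧ ∀ j, eval x (f j) = 0 := by
  by_contra! hc
  have hf0 : ∀ x, (∀ j, eval x (f j) = 0) → x = 0 := by
    intro x hx
    by_contra hx0
    obtain ⟨j, hj⟩ := hc x hx0
    exact hj (hx j)
  have hr : 0 < r := by
    rcases Nat.eq_zero_or_pos r with rfl | hr
    · have := hf0 (fun _ => 1) (fun j => j.elim0)
      exact absurd (congrFun this ⟨0, by omega⟩) one_ne_zero
    · exact hr
  set a := d ^ i with ha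
  have ha1 : 1 ≤ a := Nat.one_le_pow _ _ hd
  obtain ⟨D, hD, hφ⟩ := exists_existsAnisotropicForm_two_pow hcl (r * r)
  have hM : r * r ≤ 2 ^ (r * r) := Nat.lt_two_pow_self.le
  have key : ∀ k, ∃ M, r ≤ M ∧ (2 * r * a + 1) ^ k ≤ (2 * r) ^ k * M ∧
      ExistsAnisotropicForm F (r * M) (d ^ k * D) := by
    intro k
    induction k with
    | zero => exact ⟨r, le_rfl, by simpa using Nat.succ_le_of_lt hr, by simpa using hφ.mono hM⟩
    | succ k ih =>
      obtain ⟨M, hrM, hgr, hMφ⟩ := ih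
      have hdiv : 1 ≤ M / r := Nat.div_pos hrM hr
      have hmod := Nat.div_add_mod M r
      have hlt := Nat.mod_lt M hr
      have h2 : M ≤ 2 * r * (M / r) := by nlinarith
      refine ⟨a * M + M / r, by nlinarith, ?_, ?_⟩
      · calc (2 * r * a + 1) ^ (k + 1) = (2 * r * a + 1) ^ k * (2 * r * a + 1) := pow_succ _ _
          _ ≤ ((2 * r) ^ k * M) * (2 * r * a + 1) := Nat.mul_le_mul_right _ hgr
          _ = (2 * r) ^ k * (2 * r * (a * M) + M) := by ring
          _ ≤ (2 * r) ^ k * (2 * r * (a * M) + 2 * r * (M / r)) := by gcongr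
          _ = (2 * r) ^ (k + 1) * (a * M + M / r) := by ring
      · rw [pow_succ', mul_assoc]
        refine (ExistsAnisotropicForm.comp hf hf0 hMφ).mono ?_
        nlinarith [Nat.div_mul_le_self M r]
  obtain ⟨k, hk⟩ : ∃ k : ℕ, 2 * r * a * D ^ i < k := ⟨_, Nat.lt_succ_self _⟩
  obtain ⟨M, hrM, hgr, hMφ⟩ := key k
  have hle := hF.le_of_existsAnisotropicForm (Nat.mul_pos (pow_pos hd k) hD) hMφ
  have hle' : M ≤ a ^ k * D ^ i := by
    calc M ≤ r * M := Nat.le_mul_of_pos_left _ hr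
      _ ≤ _ := hle
      _ = _ := by rw [mul_pow, ha, ← pow_mul, ← pow_mul, mul_comm k i]
  set c := 2 * r * a with hcdef
  have hc0 : 0 < c := by positivity
  have hbern : k * c ^ k < c * (c + 1) ^ k := by
    have h1 := one_add_mul_le_pow (R := ℚ) (a := (c : ℚ)⁻¹) (by
      have : (0 : ℚ) ≤ (c : ℚ)⁻¹ := by positivity
      linarith) k
    have hcq : (0 : ℚ) < c := by exact_mod_cast hc0
    have h2 : (k : ℚ) * c ^ k < c * (c + 1) ^ k := by
      have h3 : (c + 1 : ℚ) ^ k = c ^ k * (1 + (c : ℚ)⁻¹) ^ k := by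
        rw [← mul_pow]
        congr 1
        field_simp
      have h4 : (c : ℚ) * (1 + k * (c : ℚ)⁻¹) = c + k := by field_simp
      have h5 : (c : ℚ) + k ≤ c * (1 + (c : ℚ)⁻¹) ^ k := by rw [← h4]; gcongr
      rw [h3]
      have : (0 : ℚ) < c ^ k := by positivity
      nlinarith
    exact_mod_cast h2
  have : (c + 1) ^ k ≤ c ^ k * D ^ i := by
    calc (c + 1) ^ k ≤ (2 * r) ^ k * M := hgr
      _ ≤ (2 * r) ^ k * (a ^ k * D ^ i) := by gcongr
      _ = _ := by rw [hcdef, mul_pow]; ring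
  have hpos : 0 < c ^ k := by positivity
  nlinarith

/-- Forms over an algebraically closed field, fewer than the number of variables, have a common
nontrivial zero. -/
lemma exists_common_zero_of_isAlgClosed [IsAlgClosed F] {r n d : ℕ} (hd : 1 ≤ d) (hn : r < n)
    (f : Fin r → MvPolynomial (Fin n) F) (hf : ∀ j, (f j).IsHomogeneous d) :
    ∃ x, x ≠ 0 ∧ ∀ j, eval x (f j) = 0 := by
  by_contra! hc
  let I : Ideal (MvPolynomial (Fin n) F) := Ideal.span (Set.range f)
  let m : Ideal (MvPolynomial (Fin n) F) := vanishingIdeal F {(0 : Fin n → F)}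
  have hmax : m.IsMaximal := inferInstance
  have hlocus : zeroLocus F I = {0} := by
    ext x
    rw [zeroLocus_span]
    simp only [Set.mem_range, forall_exists_index, forall_apply_eq_imp_iff, Set.mem_ofPred_eq,
      Set.mem_singleton_iff]
    constructor
    · intro hx
      by_contra hx0
      obtain ⟨j, hj⟩ := hc x hx0
      exact hj (by simpa using hx j)
    · rintro rfl j
      have := eval_const_mul_of_isHomogeneous (hf j) (0 : F) 0
      simpa [show d ≠ 0 by omega, Pi.zero_def] using this
  have hrad : I.radical = m := by
    rw [← vanishingIdeal_zeroLocus_eq_radical (K := F), hlocus]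
  have hht : m.height ≤ r := by
    have hmin : m ∈ I.minimalPrimes := by
      rw [← Ideal.radical_minimalPrimes, hrad, Ideal.minimalPrimes_eq_subsingleton_self]
      rfl
    refine (Ideal.height_le_spanRank_toENat_of_mem_minimalPrimes I m hmin).trans ?_
    rw [Submodule.spanRank_toENat_eq_iInf_finset_card]
    classical
    refine (iInf_le _ ⟨Finset.univ.image f, by simp [I, Ideal.span]⟩).trans ?_
    exact_mod_cast Finset.card_image_le.trans (by simp)
  have hdim : ringKrullDim (MvPolynomial (Fin n) F) ≤ r := by
    rw [ringKrullDim_le_iff_isMaximal_height_le]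
    intro J hJ
    obtain ⟨x, rfl⟩ := isMaximal_iff_eq_vanishingIdeal_singleton.1 hJ
    let e : MvPolynomial (Fin n) F ≃ₐ[F] MvPolynomial (Fin n) F :=
      AlgEquiv.ofAlgHom (aeval fun j => X j + C (x j)) (aeval fun j => X j - C (x j))
        (by ext; simp) (by ext; simp)
    have : vanishingIdeal F {x} = m.comap e.toRingEquiv := by
      ext p
      simp only [Ideal.mem_comap, m, mem_vanishingIdeal_singleton_iff]
      change aeval x p = 0 ↔ eval 0 (aeval (fun j => X j + C (x j)) p) = 0
      rw [eval_aeval_eq]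
      simp [aeval_eq_eval]
    rw [this, RingEquiv.height_comap]
    exact_mod_cast hht
  have := (ringKrullDim_add_natCard_le_ringKrullDim_mvPolynomial (R := F) (Fin n)).trans hdim
  rw [ringKrullDim_eq_zero_of_field] at this
  simp at this
  omega

lemma IsCField.exists_common_zero {i : ℕ} (hF : IsCField i F) {r n d : ℕ} (hd : 1 ≤ d)
    (hn : r * d ^ i < n) (f : Fin r → MvPolynomial (Fin n) F) (hf : ∀ j, (f j).IsHomogeneous d) :
    ∃ x, x ≠ 0 ∧ ∀ j, eval x (f j) = 0 := by
  by_cases hcl : IsAlgClosed F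
  · exact exists_common_zero_of_isAlgClosed hd
      ((Nat.le_mul_of_pos_right r (Nat.one_le_pow _ _ hd)).trans_lt hn) f hf
  · exact hF.exists_common_zero_of_not_isAlgClosed hcl hd hn f hf

end Forms

section Truncation

open MvPolynomial

variable {F : Type*} [Field F]

/-- All coefficients of a univariate polynomial over a multivariate polynomial ring are
homogeneous of degree `m`. -/
def HasHomogeneousCoeffs {σ A : Type*} [CommSemiring A] (q : Polynomial (MvPolynomial σ A))
    (m : ℕ) : Prop :=
  ∀ l, (q.coeff l).IsHomogeneous m

lemma HasHomogeneousCoeffs.mul {σ A : Type*} [CommSemiring A]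
    {p q : Polynomial (MvPolynomial σ A)} {m k : ℕ} (hp : HasHomogeneousCoeffs p m)
    (hq : HasHomogeneousCoeffs q k) : HasHomogeneousCoeffs (p * q) (m + k) := by
  intro l
  rw [Polynomial.coeff_mul]
  exact IsHomogeneous.sum _ _ _ fun c _ => (hp _).mul (hq _)

lemma HasHomogeneousCoeffs.one {σ A : Type*} [CommSemiring A] :
    HasHomogeneousCoeffs (1 : Polynomial (MvPolynomial σ A)) 0 := by
  intro l
  rw [Polynomial.coeff_one]
  split_ifs
  · exact isHomogeneous_one _ _
  · exact isHomogeneous_zero _ _ _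

lemma HasHomogeneousCoeffs.pow {σ A : Type*} [CommSemiring A]
    {p : Polynomial (MvPolynomial σ A)} {m : ℕ} (hp : HasHomogeneousCoeffs p m) (k : ℕ) :
    HasHomogeneousCoeffs (p ^ k) (k * m) := by
  induction k with
  | zero => simpa using HasHomogeneousCoeffs.one
  | succ k ih => simpa [pow_succ, add_mul] using ih.mul hp

lemma HasHomogeneousCoeffs.prod {σ A ι : Type*} [CommSemiring A] (s : Finset ι)
    {p : ι → Polynomial (MvPolynomial σ A)} {m : ι → ℕ}
    (hp : ∀ j ∈ s, HasHomogeneousCoeffs (p j) (m j)) :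
    HasHomogeneousCoeffs (∏ j ∈ s, p j) (∑ j ∈ s, m j) := by
  classical
  induction s using Finset.induction_on with
  | empty => simpa using HasHomogeneousCoeffs.one
  | insert a s ha ih =>
    rw [Finset.prod_insert ha, Finset.sum_insert ha]
    exact (hp a (by simp)).mul (ih fun j hj => hp j (by simp [hj]))

/-- The special case of Tsen and Lang: a form over `F[t]` in more than `d ^ (i + 1)` variables
has a nontrivial zero. -/
lemma IsCField.exists_polynomial_zero {i : ℕ} (hF : IsCField i F) {n d : ℕ} (hd : 1 ≤ d)
    (hn : d ^ (i + 1) < n) (g : MvPolynomial (Fin n) (Polynomial F)) (hg : g.IsHomogeneous d) :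
    ∃ y, y ≠ 0 ∧ eval y g = 0 := by
  obtain ⟨N, hN⟩ : ∃ N, ∀ m ∈ g.support, (coeff m g).natDegree ≤ N :=
    ⟨g.support.sup fun m => (coeff m g).natDegree,
      fun m hm => Finset.le_sup (f := fun m => (coeff m g).natDegree) hm⟩
  set s := (N + 1) * d ^ i with hs
  let σ := Fin n × Fin (s + 1)
  let Y : Fin n → Polynomial (MvPolynomial σ F) := fun j =>
    ∑ k : Fin (s + 1), Polynomial.monomial k (X (j, k))
  have hYcoeff : ∀ j, HasHomogeneousCoeffs (Y j) 1 := by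
    intro j l
    simp only [Y, Polynomial.finsetSum_coeff, Polynomial.coeff_monomial]
    refine IsHomogeneous.sum _ _ _ fun k _ => ?_
    split_ifs
    · exact isHomogeneous_X _ _
    · exact isHomogeneous_zero _ _ _
  have hYdeg : ∀ j, (Y j).natDegree ≤ s := fun j =>
    Polynomial.natDegree_sum_le_of_forall_le _ _ fun k _ =>
      (Polynomial.natDegree_monomial_le _).trans (Nat.le_of_lt_succ k.2)
  let φ : Polynomial F →+* Polynomial (MvPolynomial σ F) := Polynomial.mapRingHom C
  let G := eval₂ φ Y g
  have hsum : ∀ m ∈ g.support, ∑ j ∈ m.support, m j = d := by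
    intro m hm
    have := hg (mem_support_iff.1 hm)
    rwa [Pi.one_def, ← Finsupp.degree_eq_weight_one] at this
  have hG : HasHomogeneousCoeffs G d := by
    intro l
    simp only [G, eval₂_eq, Polynomial.finsetSum_coeff]
    refine IsHomogeneous.sum _ _ _ fun m hm => ?_
    have h1 : HasHomogeneousCoeffs (φ (coeff m g)) 0 := fun l => by
      simpa [φ] using isHomogeneous_C _ _
    have h2 := h1.mul (HasHomogeneousCoeffs.prod m.support fun j _ => (hYcoeff j).pow (m j))
    simp only [mul_one, hsum m hm, zero_add] at h2
    exact h2 l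
  have hGdeg : G.natDegree ≤ N + d * s := by
    simp only [G, eval₂_eq]
    refine Polynomial.natDegree_sum_le_of_forall_le _ _ fun m hm => ?_
    refine Polynomial.natDegree_mul_le.trans (add_le_add ?_ ?_)
    · exact Polynomial.natDegree_map_le.trans (hN m hm)
    · refine (Polynomial.natDegree_prod_le _ _).trans ?_
      rw [← hsum m hm, Finset.sum_mul]
      exact Finset.sum_le_sum fun j _ =>
        Polynomial.natDegree_pow_le.trans (Nat.mul_le_mul_left _ (hYdeg j))
  let e : σ ≃ Fin (n * (s + 1)) := finProdFinEquiv
  obtain ⟨a, ha, hza⟩ := hF.exists_common_zero (r := N + d * s + 1) (n := n * (s + 1)) hd (by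
      calc (N + d * s + 1) * d ^ i = (N + 1) * d ^ i + d ^ (i + 1) * s := by ring
        _ = (d ^ (i + 1) + 1) * s := by rw [← hs]; ring
        _ < (d ^ (i + 1) + 1) * (s + 1) := by gcongr; omega
        _ ≤ n * (s + 1) := Nat.mul_le_mul_right _ hn)
      (fun l => rename e (G.coeff l)) (fun l => (hG l).rename_isHomogeneous)
  let ev : MvPolynomial σ F →+* F := eval (a ∘ e)
  have hG0 : G.map ev = 0 := by
    ext l
    rw [Polynomial.coeff_map, Polynomial.coeff_zero]
    by_cases hl : l < N + d * s + 1
    · simpa [eval_rename] using hza ⟨l, hl⟩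
    · rw [Polynomial.coeff_eq_zero_of_natDegree_lt (by omega), map_zero]
  refine ⟨fun j => (Y j).map ev, fun h0 => ha ?_, ?_⟩
  · funext p
    obtain ⟨⟨j, k⟩, rfl⟩ := e.surjective p
    have := congrArg (Polynomial.coeff · k) (congrFun h0 j)
    simpa [Y, Polynomial.coeff_map, Polynomial.finsetSum_coeff, Polynomial.coeff_monomial, ev,
      Fin.val_inj] using this
  · rw [← hG0]
    change _ = Polynomial.mapRingHom ev (eval₂ φ Y g)
    rw [← coe_eval₂Hom, ← RingHom.comp_apply, comp_eval₂Hom, eval, coe_eval₂Hom]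
    have : (Polynomial.mapRingHom ev).comp φ = RingHom.id _ := by
      ext <;> simp [φ, ev]
    rw [this]
    rfl

lemma exists_eq_X_pow_mul_of_ne_zero {n : ℕ} {z : Fin n → PowerSeries F} (hz : z ≠ 0) :
    ∃ (v : ℕ) (w : Fin n → PowerSeries F), (z = fun j => PowerSeries.X ^ v * w j) ∧
      ∃ j, PowerSeries.constantCoeff (w j) ≠ 0 := by
  classical
  have hex : ∃ k, ∃ j, PowerSeries.coeff k (z j) ≠ 0 := by
    by_contra! hc
    exact hz (funext fun j => PowerSeries.ext fun k => by simpa using hc k j)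
  have hdvd : ∀ j, PowerSeries.X ^ (Nat.find hex) ∣ z j := by
    intro j
    rw [PowerSeries.X_pow_dvd_iff]
    intro m hm
    have := Nat.find_min hex hm
    push Not at this
    exact this j
  choose w hw using hdvd
  refine ⟨Nat.find hex, w, funext hw, ?_⟩
  obtain ⟨j, hj⟩ := Nat.find_spec hex
  refine ⟨j, ?_⟩
  rw [hw j] at hj
  simpa [PowerSeries.coeff_X_pow_mul'] using hj

lemma IsCField.exists_approximate_zero {i : ℕ} (hF : IsCField i F) {n d : ℕ} (hd : 1 ≤ d)
    (hn : d ^ (i + 1) < n) (f : MvPolynomial (Fin n) (PowerSeries F)) (hf : f.IsHomogeneous d)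
    (N : ℕ) : ∃ w : Fin n → PowerSeries F,
      (∃ j, PowerSeries.constantCoeff (w j) ≠ 0) ∧ PowerSeries.X ^ N ∣ eval w f := by
  let g : MvPolynomial (Fin n) (Polynomial F) :=
    ∑ m ∈ f.support, monomial m (PowerSeries.trunc N (coeff m f))
  have hg : g.IsHomogeneous d := IsHomogeneous.sum _ _ _ fun m hm => by
    refine isHomogeneous_monomial _ ?_
    have := hf (mem_support_iff.1 hm)
    rwa [Pi.one_def, ← Finsupp.degree_eq_weight_one] at this
  obtain ⟨y, hy, hy0⟩ := hF.exists_polynomial_zero hd hn g hg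
  let ι : Polynomial F →+* PowerSeries F := Polynomial.coeToPowerSeries.ringHom
  have hz : (fun j => ι (y j)) ≠ 0 := by
    intro h0
    refine hy (funext fun j => Polynomial.coe_injective F ?_)
    simpa [ι] using congrFun h0 j
  obtain ⟨v, w, hw, hw0⟩ := exists_eq_X_pow_mul_of_ne_zero hz
  refine ⟨w, hw0, ?_⟩
  have h1 : eval w (map ι g) = 0 := by
    have h2 : eval (fun j => ι (y j)) (map ι g) = 0 := by
      rw [eval_map, ← map_zero ι, ← hy0]
      exact (eval₂_comp_left ι (RingHom.id _) y g).symm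
    rw [hw, eval_const_mul_of_isHomogeneous (hg.map ι)] at h2
    exact (mul_eq_zero.1 h2).resolve_left (pow_ne_zero _ (pow_ne_zero _ PowerSeries.X_ne_zero))
  have h3 : eval w f = eval w (f - map ι g) := by rw [map_sub, h1, sub_zero]
  have h4 : f - map ι g = ∑ m ∈ f.support,
      monomial m (coeff m f - ι (PowerSeries.trunc N (coeff m f))) := by
    conv_lhs => rw [f.as_sum]
    simp [g, map_monomial, Finset.sum_sub_distrib]
  rw [h3, h4, map_sum]
  refine Finset.dvd_sum fun m _ => ?_
  rw [eval_monomial]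
  refine Dvd.dvd.mul_right ?_ _
  rw [PowerSeries.X_pow_dvd_iff]
  intro k hk
  simp [ι, PowerSeries.coeff_trunc, hk]

end Truncation

section CartierOperator

open PowerSeries

/-- The Cartier-type operator `∑ cₘ tᵐ ↦ ∑ μ(c_{pk+a}) tᵏ` on power series. -/
noncomputable def cartierOperator {G : Type*} [Field G] (μ : G →+ G) (p a : ℕ) :
    PowerSeries G →+ PowerSeries G where
  toFun c := PowerSeries.mk fun k => μ (coeff (p * k + a) c)
  map_zero' := by ext; simp
  map_add' _ _ := by ext; simp

lemma coeff_cartierOperator {G : Type*} [Field G] (μ : G →+ G) (p a k : ℕ) (c : PowerSeries G) :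
    coeff k (cartierOperator μ p a c) = μ (coeff (p * k + a) c) := by
  simp [cartierOperator]

lemma cartierOperator_pow_mul {G : Type*} [Field G] {p : ℕ} [Fact p.Prime] [CharP G p]
    {μ : G →+ G} (hμ : ∀ x y, μ (x ^ p * y) = x * μ y) {a : ℕ} (ha : a < p)
    (z c : PowerSeries G) :
    cartierOperator μ p a (z ^ p * c) = z * cartierOperator μ p a c := by
  have : CharP (PowerSeries G) p :=
    charP_of_injective_algebraMap (algebraMap G (PowerSeries G)).injective p
  have hpoly : ∀ (q : Polynomial G) (c : PowerSeries G),
      cartierOperator μ p a ((q : PowerSeries G) ^ p * c) = q * cartierOperator μ p a c := by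
    have hX : ∀ c : PowerSeries G,
        cartierOperator μ p a (X ^ p * c) = X * cartierOperator μ p a c := by
      intro c
      ext k
      rcases k with _ | k
      · simp [coeff_cartierOperator, coeff_X_pow_mul', ha.not_ge]
      · rw [coeff_succ_X_mul, coeff_cartierOperator, coeff_cartierOperator,
          show p * (k + 1) + a = (p * k + a) + p by ring, coeff_X_pow_mul]
    have hC : ∀ (b : G) (c : PowerSeries G),
        cartierOperator μ p a (C b ^ p * c) = C b * cartierOperator μ p a c := by
      intro b c
      ext k
      rw [← map_pow, coeff_C_mul, coeff_cartierOperator, coeff_cartierOperator, coeff_C_mul, hμ]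
    intro q
    induction q using Polynomial.induction_on' with
    | add q r hq hr =>
      intro c
      rw [Polynomial.coe_add, add_pow_char, add_mul, map_add, hq, hr, add_mul]
    | monomial m b =>
      intro c
      have hXm : ∀ (m : ℕ) (c : PowerSeries G), cartierOperator μ p a ((X ^ m) ^ p * c) =
          X ^ m * cartierOperator μ p a c := by
        intro m
        induction m with
        | zero => simp
        | succ m ih =>
          intro c
          rw [pow_succ, mul_pow, mul_assoc, ih, hX, mul_assoc]
      rw [← Polynomial.C_mul_X_pow_eq_monomial, Polynomial.coe_mul, Polynomial.coe_C,
        Polynomial.coe_pow, Polynomial.coe_X, mul_pow, mul_assoc, hC, hXm, mul_assoc]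
  ext k
  obtain ⟨w, hw⟩ : X ^ (k + 1) ∣ z - (trunc (k + 1) z : PowerSeries G) := by
    rw [X_pow_dvd_iff]
    intro m hm
    simp [coeff_trunc, hm]
  rw [sub_eq_iff_eq_add'] at hw
  rw [hw, add_pow_char, add_mul, add_mul, map_add, hpoly, map_add, map_add]
  congr 1
  rw [coeff_cartierOperator, mul_pow, mul_assoc, mul_assoc, ← pow_mul, coeff_X_pow_mul',
    coeff_X_pow_mul', if_neg (by nlinarith), if_neg (by omega), map_zero]

lemma exists_dual_apply_ne_zero {F V : Type*} [Field F] [AddCommGroup V] [Module F V] {y : V}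
    (hy : y ≠ 0) : ∃ φ : V →+ F, (∀ (a : F) (x : V), φ (a • x) = a * φ x) ∧ φ y ≠ 0 := by
  by_contra! hc
  exact hy ((Module.forall_dual_apply_eq_zero_iff F y).1 fun φ =>
    hc φ.toAddMonoidHom fun a x => φ.map_smul a x)

lemma exists_frobenius_inverse_linear {F : Type*} [Field F] {p : ℕ} [Fact p.Prime] [CharP F p]
    {y : F} (hy : y ≠ 0) : ∃ μ : F →+ F, (∀ a x, μ (a ^ p * x) = a * μ x) ∧ μ y ≠ 0 :=
  @exists_dual_apply_ne_zero F F _ _ (Module.compHom F (frobenius F p)) y hy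

end CartierOperator

section Ultrapower

open PowerSeries Filter

variable (F : Type*) [Field F]

/-- The ultrapower of `F` along a nonprincipal ultrafilter on `ℕ`. -/
abbrev Ultrapower : Type _ := Germ (hyperfilter ℕ : Filter ℕ) F

/-- The diagonal embedding into the ultrapower. -/
noncomputable def Ultrapower.diag : F →+* Ultrapower F :=
  (Germ.coeRingHom _).comp (Pi.constRingHom ℕ F)

/-- A sequence of power series gives a power series over the ultrapower. -/
noncomputable def seqLimit : (ℕ → PowerSeries F) →+* PowerSeries (Ultrapower F) where
  toFun a := PowerSeries.mk fun k => Germ.coeRingHom _ fun N => coeff k (a N)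
  map_zero' := by ext k; simp [← Pi.zero_def]
  map_one' := by
    ext k
    simp only [Pi.one_apply, coeff_mk, coeff_one]
    split_ifs
    · exact map_one _
    · exact map_zero _
  map_add' a b := by
    ext k
    simp only [Pi.add_apply, coeff_mk, map_add]
    exact map_add _ _ _
  map_mul' a b := by
    ext k
    simp only [Pi.mul_apply, coeff_mk, coeff_mul, ← map_mul, ← map_sum]
    congr 1
    funext N
    simp

variable {F}

lemma coeff_seqLimit (a : ℕ → PowerSeries F) (k : ℕ) :
    coeff k (seqLimit F a) = ((fun N => coeff k (a N) : ℕ → F) : Ultrapower F) := by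
  simp [seqLimit]

lemma seqLimit_surjective : Function.Surjective (seqLimit F) := by
  intro b
  have hrep : ∀ x : Ultrapower F, ∃ g : ℕ → F, (g : Ultrapower F) = x := fun x =>
    x.inductionOn fun g => ⟨g, rfl⟩
  choose a ha using fun k => hrep (coeff k b)
  refine ⟨fun N => PowerSeries.mk fun k => a k N, ?_⟩
  ext k
  rw [coeff_seqLimit, ← ha k]
  simp only [coeff_mk]

lemma seqLimit_const (c : PowerSeries F) :
    seqLimit F (fun _ => c) = PowerSeries.map (Ultrapower.diag F) c := by
  ext k
  rw [coeff_seqLimit, coeff_map]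
  rfl

lemma coeff_seqLimit_eq_zero_iff {a : ℕ → PowerSeries F} {k : ℕ} :
    coeff k (seqLimit F a) = 0 ↔ ∀ᶠ N in hyperfilter ℕ, coeff k (a N) = 0 := by
  rw [coeff_seqLimit]
  exact Germ.coe_eq

lemma eventually_X_pow_dvd_of_seqLimit_eq_zero {a : ℕ → PowerSeries F} (h : seqLimit F a = 0)
    (M : ℕ) : ∀ᶠ N in hyperfilter ℕ, X ^ M ∣ a N := by
  have : ∀ᶠ N in hyperfilter ℕ, ∀ k ∈ Finset.range M, coeff k (a N) = 0 := by
    rw [Filter.eventually_all_finset]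
    intro k _
    exact coeff_seqLimit_eq_zero_iff.1 (by rw [h, map_zero])
  filter_upwards [this] with N hN
  rw [X_pow_dvd_iff]
  exact fun m hm => hN m (Finset.mem_range.2 hm)

lemma seqLimit_eq_zero_of_X_pow_dvd {a : ℕ → PowerSeries F} (h : ∀ N, X ^ N ∣ a N) :
    seqLimit F a = 0 := by
  ext k
  rw [map_zero, coeff_seqLimit_eq_zero_iff]
  have : ∀ᶠ N in (hyperfilter ℕ : Filter ℕ), k < N :=
    Nat.hyperfilter_le_atTop (eventually_gt_atTop k)
  filter_upwards [this] with N hN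
  exact X_pow_dvd_iff.1 (h N) k hN

lemma exists_eventually_not_X_pow_dvd_of_seqLimit_ne_zero {a : ℕ → PowerSeries F}
    (h : seqLimit F a ≠ 0) : ∃ e, ∀ᶠ N in hyperfilter ℕ, ¬ X ^ e ∣ a N := by
  obtain ⟨k, hk⟩ : ∃ k, coeff k (seqLimit F a) ≠ 0 := by
    by_contra! hc
    exact h (PowerSeries.ext fun k => by simpa using hc k)
  rw [Ne, coeff_seqLimit_eq_zero_iff, ← Ultrafilter.eventually_not] at hk
  refine ⟨k + 1, ?_⟩
  filter_upwards [hk] with N hN hdvd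
  exact hN (X_pow_dvd_iff.1 hdvd k (Nat.lt_succ_self k))

/-- A relation between `p`-th powers over the ultrapower yields, for each Cartier operator, a
relation between the elements themselves. -/
lemma sum_cartierOperator_mul_eq_zero {p : ℕ} [Fact p.Prime] [CharP F p] {μ : F →+ F}
    (hμ : ∀ x y, μ (x ^ p * y) = x * μ y) {a : ℕ} (ha : a < p) {ι : Type*} (s : Finset ι)
    (c : ι → PowerSeries F) (β : ι → PowerSeries (Ultrapower F))
    (h : ∑ j ∈ s, PowerSeries.map (Ultrapower.diag F) (c j) * β j ^ p = 0) :
    ∑ j ∈ s, PowerSeries.map (Ultrapower.diag F) (cartierOperator μ p a (c j)) * β j = 0 := by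
  have : CharP (Ultrapower F) p := charP_of_injective_ringHom (Ultrapower.diag F).injective p
  let ν : Ultrapower F →+ Ultrapower F :=
    { toFun := Germ.map μ
      map_zero' := by
        change ((_ : ℕ → F) : Ultrapower F) = ((_ : ℕ → F) : Ultrapower F)
        congr 1
        funext N
        simp
      map_add' := by
        intro x y
        induction x using Germ.inductionOn
        induction y using Germ.inductionOn
        change ((_ : ℕ → F) : Ultrapower F) = ((_ : ℕ → F) : Ultrapower F)
        congr 1
        funext N
        simp }
  have hν : ∀ x y, ν (x ^ p * y) = x * ν y := by
    intro x y
    induction x using Germ.inductionOn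
    induction y using Germ.inductionOn
    change ((_ : ℕ → F) : Ultrapower F) = ((_ : ℕ → F) : Ultrapower F)
    congr 1
    funext N
    exact hμ _ _
  have hcomp : ∀ c, cartierOperator ν p a (PowerSeries.map (Ultrapower.diag F) c) =
      PowerSeries.map (Ultrapower.diag F) (cartierOperator μ p a c) := by
    intro c
    ext k
    rw [coeff_cartierOperator, coeff_map, coeff_map, coeff_cartierOperator]
    rfl
  have h1 := congrArg (cartierOperator ν p a) h
  rw [map_sum, map_zero] at h1
  rw [← h1]
  refine Finset.sum_congr rfl fun j _ => ?_
  rw [mul_comm _ (β j ^ p), cartierOperator_pow_mul hν ha, hcomp, mul_comm]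

end Ultrapower

section Hensel

open PowerSeries Polynomial

variable {F : Type*} [Field F]

lemma exists_X_pow_dvd_sub_of_X_pow_dvd_succ_sub {a : ℕ → PowerSeries F}
    (h : ∀ k, (PowerSeries.X : PowerSeries F) ^ k ∣ a (k + 1) - a k) :
    ∃ b, ∀ k, (PowerSeries.X : PowerSeries F) ^ k ∣ b - a k := by
  have hadd : ∀ k l, (PowerSeries.X : PowerSeries F) ^ k ∣ a (k + l) - a k := by
    intro k l
    induction l with
    | zero => simp
    | succ l ih =>
      have := dvd_add ((pow_dvd_pow _ (Nat.le_add_right k l)).trans (h (k + l))) ih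
      rwa [sub_add_sub_cancel] at this
  refine ⟨PowerSeries.mk fun m => PowerSeries.coeff m (a (m + 1)), fun k => ?_⟩
  rw [PowerSeries.X_pow_dvd_iff]
  intro m hm
  obtain ⟨l, rfl⟩ := Nat.exists_eq_add_of_lt hm
  have := PowerSeries.X_pow_dvd_iff.1 (hadd (m + 1) l) m m.lt_succ_self
  rw [map_sub, sub_eq_zero, show m + 1 + l = m + l + 1 by ring] at this
  rw [map_sub, PowerSeries.coeff_mk, this, sub_self]

lemma eq_zero_of_forall_X_pow_dvd {a : PowerSeries F}
    (h : ∀ k, (PowerSeries.X : PowerSeries F) ^ k ∣ a) : a = 0 :=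
  PowerSeries.ext fun k => PowerSeries.X_pow_dvd_iff.1 (h (k + 1)) k k.lt_succ_self

/-- Hensel's lemma for power series, in the form of an approximate root at which the derivative
may vanish to positive order. -/
lemma exists_root_of_approximate_root (G : (PowerSeries F)[X]) (a : PowerSeries F) (e : ℕ)
    (hder : ¬ (PowerSeries.X : PowerSeries F) ^ e ∣ (derivative G).eval a)
    (ha : (PowerSeries.X : PowerSeries F) ^ (2 * e) ∣ G.eval a) :
    ∃ b, G.eval b = 0 ∧ (PowerSeries.X : PowerSeries F) ^ e ∣ b - a := by
  set x : PowerSeries F := PowerSeries.X with hx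
  set u := (derivative G).eval a with hu
  obtain ⟨m, v, hv, hm⟩ : ∃ m v, IsUnit v ∧ u = x ^ m * v := by
    have hu0 : u ≠ 0 := fun h => hder (h ▸ dvd_zero _)
    exact ⟨_, _, isUnit_divided_by_X_pow_order hu0, (X_pow_order_mul_divXPowOrder (f := u)).symm⟩
  have hme : m < e := by
    by_contra! hc
    exact hder (hm ▸ (pow_dvd_pow x hc).mul_right v)
  have step : ∀ (k : ℕ) (b : PowerSeries F), x ^ (2 * e + k) ∣ G.eval b → x ^ e ∣ b - a →
      ∃ c, (x ^ (2 * e + (k + 1)) ∣ G.eval c ∧ x ^ e ∣ c - a) ∧ x ^ k ∣ c - b := by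
    intro k b hb hba
    obtain ⟨g, hg⟩ := hb
    obtain ⟨w, rfl⟩ := hv
    obtain ⟨l, rfl⟩ := Nat.exists_eq_add_of_lt hme
    obtain ⟨δ, hδ⟩ : ∃ δ, δ = - (x ^ (m + l + 1 + l + 1 + k) * (↑w⁻¹ * g)) := ⟨_, rfl⟩
    have hδu : G.eval b + u * δ = 0 := by
      rw [hg, hm, hδ]
      linear_combination (-(x ^ (2 * (m + l + 1) + k) * g)) * w.mul_inv
    obtain ⟨κ, hκ⟩ := G.binomExpansion b δ
    obtain ⟨ρ, hρ⟩ := hba.trans ((derivative G).sub_dvd_eval_sub b a)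
    refine ⟨b + δ, ⟨?_, ?_⟩, ?_⟩
    · refine ⟨- ρ * x ^ l * (↑w⁻¹ * g) + κ * (↑w⁻¹ * g) ^ 2 * x ^ (2 * l + 1 + k), ?_⟩
      rw [hκ]
      rw [← hu] at hρ
      subst hδ
      linear_combination hδu + (-(x ^ (m + l + 1 + l + 1 + k) * (↑w⁻¹ * g))) * hρ
    · rw [add_sub_right_comm]
      exact dvd_add hba (hδ ▸ dvd_neg.2 (Dvd.dvd.mul_right (pow_dvd_pow _ (by omega)) _))
    · rw [add_sub_cancel_left]
      exact hδ ▸ dvd_neg.2 (Dvd.dvd.mul_right (pow_dvd_pow _ (by omega)) _)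
  have hstep : ∀ (k : ℕ) (b : {b // x ^ (2 * e + k) ∣ G.eval b ∧ x ^ e ∣ b - a}),
      ∃ c : {b // x ^ (2 * e + (k + 1)) ∣ G.eval b ∧ x ^ e ∣ b - a},
        x ^ k ∣ (c : PowerSeries F) - b := by
    rintro k ⟨b, hb⟩
    obtain ⟨c, hc, hcb⟩ := step k b hb.1 hb.2
    exact ⟨⟨c, hc⟩, hcb⟩
  choose next hnext using hstep
  let s : ∀ k : ℕ, {b // x ^ (2 * e + k) ∣ G.eval b ∧ x ^ e ∣ b - a} := fun k =>
    Nat.rec ⟨a, by simpa using ha, by simp⟩ next k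
  obtain ⟨b, hb⟩ := exists_X_pow_dvd_sub_of_X_pow_dvd_succ_sub
    (a := fun k => (s k).1) fun k => hnext k (s k)
  refine ⟨b, eq_zero_of_forall_X_pow_dvd fun k => ?_, ?_⟩
  · have h1 := (hb k).trans (G.sub_dvd_eval_sub b (s k).1)
    have h2 := dvd_add h1 ((pow_dvd_pow x (by omega : k ≤ 2 * e + k)).trans (s k).2.1)
    rwa [sub_add_cancel] at h2
  · have := dvd_add (hb e) (s e).2.2
    rwa [sub_add_sub_cancel] at this

end Hensel

section HypersurfaceModel

open Polynomial

/-- A separable element and finitely many elements of the simple extension it generates, described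
by polynomials with coefficients in a domain. -/
lemma exists_polynomial_model_of_isSeparable {P K L : Type*} [CommRing P] [IsDomain P] [Field K]
    [Field L] [Algebra P K] [IsFractionRing P K] [Algebra K L] [Algebra P L] [IsScalarTower P K L]
    {θ : L} (hθ : IsSeparable K θ) {κ : Type*} [Finite κ] (x : κ → L)
    (hx : ∀ j, x j ∈ IntermediateField.adjoin K {θ}) :
    ∃ (μ : P[X]) (q : P) (g : κ → P[X]), aeval θ μ = 0 ∧ aeval θ (derivative μ) ≠ 0 ∧ q ≠ 0 ∧
      (∀ j, aeval θ (g j) = algebraMap P L q * x j) ∧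
      ∀ h : P[X], aeval θ h = 0 → ∃ r ≠ 0, μ ∣ C r * h := by
  have hint : IsIntegral K θ := hθ.isIntegral
  have hinj : Function.Injective (algebraMap P K) := IsFractionRing.injective P K
  have hnorm : ∀ h : K[X], ∃ b : P, b ≠ 0 ∧ ∃ h' : P[X],
      h'.map (algebraMap P K) = C (algebraMap P K b) * h := by
    intro h
    obtain ⟨b, hb, hbh⟩ := IsLocalization.integerNormalization_spec (nonZeroDivisors P) h
    refine ⟨b, nonZeroDivisors.ne_zero hb, _, hbh.trans ?_⟩
    rw [← Polynomial.smul_eq_C_mul, algebraMap_smul]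
  obtain ⟨b, hb, μ, hμ⟩ := hnorm (minpoly K θ)
  have hb' : algebraMap P K b ≠ 0 := (map_ne_zero_iff _ hinj).2 hb
  have haeval : ∀ h : P[X], aeval θ h = aeval θ (h.map (algebraMap P K)) := fun h =>
    (aeval_map_algebraMap K θ h).symm
  have hpoly : ∀ j, ∃ h : K[X], aeval θ h = x j := by
    intro j
    have := hx j
    rwa [← IntermediateField.mem_toSubalgebra,
      IntermediateField.adjoin_simple_toSubalgebra_of_isAlgebraic hint.isAlgebraic,
      Algebra.adjoin_singleton_eq_range_aeval] at this
  choose h hh using hpoly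
  choose c hc g hg using fun j => hnorm (h j)
  have := Fintype.ofFinite κ
  classical
  refine ⟨μ, ∏ j, c j, fun j => C (∏ l ∈ Finset.univ.erase j, c l) * g j, ?_, ?_,
    Finset.prod_ne_zero_iff.2 fun j _ => hc j, ?_, ?_⟩
  · rw [haeval, hμ, map_mul, minpoly.aeval, mul_zero]
  · rw [haeval, ← derivative_map, hμ, derivative_C_mul, map_mul, aeval_C]
    exact mul_ne_zero (by simpa using hb') (hθ.aeval_derivative_ne_zero (minpoly.aeval K θ))
  · intro j
    rw [map_mul, haeval (g j), hg, map_mul, hh, aeval_C, aeval_C,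
      ← Finset.prod_erase_mul _ _ (Finset.mem_univ j), map_mul,
      ← IsScalarTower.algebraMap_apply, mul_assoc]
  · intro h hzero
    rw [haeval] at hzero
    obtain ⟨w, hw⟩ := minpoly.dvd K θ hzero
    obtain ⟨r, hr, w', hw'⟩ := hnorm w
    refine ⟨b * r, mul_ne_zero hb hr, w', map_injective _ hinj ?_⟩
    rw [Polynomial.map_mul, Polynomial.map_mul, hμ, hw', hw, map_C, map_mul, C_mul]
    ring

lemma exists_map_eq_C_mul {R k σ : Type*} [CommRing R] [IsDomain R] [Field k] [Algebra R k]
    [IsFractionRing R k] (a : MvPolynomial σ k) : ∃ c : R, c ≠ 0 ∧ ∃ a' : MvPolynomial σ R,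
      MvPolynomial.map (algebraMap R k) a' = MvPolynomial.C (algebraMap R k c) * a := by
  induction a using MvPolynomial.induction_on with
  | C b =>
    obtain ⟨u, v, hv, rfl⟩ := IsFractionRing.div_surjective (A := R) b
    have hv' : algebraMap R k v ≠ 0 :=
      (map_ne_zero_iff _ (IsFractionRing.injective R k)).2 (nonZeroDivisors.ne_zero hv)
    refine ⟨v, nonZeroDivisors.ne_zero hv, MvPolynomial.C u, ?_⟩
    rw [MvPolynomial.map_C, ← MvPolynomial.C_mul, mul_div_cancel₀ _ hv']
  | add a b ha hb =>
    obtain ⟨c, hc, a', ha'⟩ := ha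
    obtain ⟨e, he, b', hb'⟩ := hb
    refine ⟨c * e, mul_ne_zero hc he, MvPolynomial.C e * a' + MvPolynomial.C c * b', ?_⟩
    simp only [map_add, map_mul, MvPolynomial.map_C, ha', hb']
    ring
  | mul_X a i ha =>
    obtain ⟨c, hc, a', ha'⟩ := ha
    refine ⟨c, hc, a' * MvPolynomial.X i, ?_⟩
    rw [map_mul, ha', MvPolynomial.map_X, mul_assoc]

lemma AlgebraicIndependent.const_mul {k L ι : Type*} [Field k] [Field L] [Algebra k L] {x : ι → L}
    (hx : AlgebraicIndependent k x) {c : ι → k} (hc : ∀ i, c i ≠ 0) :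
    AlgebraicIndependent k fun i => algebraMap k L (c i) * x i := by
  let scale (e : ι → k) : MvPolynomial ι k →ₐ[k] MvPolynomial ι k :=
    MvPolynomial.aeval fun i => MvPolynomial.C (e i) * MvPolynomial.X i
  have hleft : (scale fun i => (c i)⁻¹).comp (scale c) = AlgHom.id k _ := by
    ext1 i
    simp [scale, MvPolynomial.algebraMap_eq, ← mul_assoc, ← MvPolynomial.C_mul, hc i]
  have hcomp : MvPolynomial.aeval (fun i => algebraMap k L (c i) * x i) =
      (MvPolynomial.aeval x).comp (scale c) := by
    ext1 i
    simp [scale]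
  rw [AlgebraicIndependent, hcomp, AlgHom.coe_comp]
  exact Function.Injective.comp hx (Function.LeftInverse.injective
    (g := scale fun i => (c i)⁻¹) fun a => DFunLike.congr_fun hleft a)

/-- A separably generated extension of `Frac R` has a hypersurface model over `R` with generators
in any subring meeting every `R`-line. -/
lemma exists_hypersurface_model {R k L : Type*} [CommRing R] [IsDomain R] [Field k] [Field L]
    [Algebra R k] [IsFractionRing R k] [Algebra k L] [Algebra R L] [IsScalarTower R k L]
    [Algebra.EssFiniteType k L] (B : Subring L)
    (hB : ∀ z : L, ∃ r : R, r ≠ 0 ∧ algebraMap R L r * z ∈ B) (s : Finset L)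
    (hs : AlgebraicIndependent k ((↑) : s → L))
    (hsep : Algebra.IsSeparable (IntermediateField.adjoin k (s : Set L)) L)
    {κ : Type*} [Finite κ] (x : κ → L) :
    ∃ (T : s → L) (θ : L), (∀ i, T i ∈ B) ∧ θ ∈ B ∧ AlgebraicIndependent R T ∧
      ∃ (μ : (MvPolynomial s R)[X]) (q : MvPolynomial s R) (g : κ → (MvPolynomial s R)[X]),
        eval₂ (MvPolynomial.aeval T).toRingHom θ μ = 0 ∧
        eval₂ (MvPolynomial.aeval T).toRingHom θ (derivative μ) ≠ 0 ∧ q ≠ 0 ∧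
        (∀ j, eval₂ (MvPolynomial.aeval T).toRingHom θ (g j) = MvPolynomial.aeval T q * x j) ∧
        ∀ h : (MvPolynomial s R)[X], eval₂ (MvPolynomial.aeval T).toRingHom θ h = 0 →
          ∃ r ≠ 0, μ ∣ C r * h := by
  have hinj : Function.Injective (algebraMap R k) := IsFractionRing.injective R k
  choose c hc hcB using fun i : s => hB i
  let T : s → L := fun i => algebraMap R L (c i) * i
  have hc' : ∀ i, algebraMap R k (c i) ≠ 0 := fun i => (map_ne_zero_iff _ hinj).2 (hc i)
  have hT : AlgebraicIndependent k T := by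
    have := hs.const_mul hc'
    simpa only [← IsScalarTower.algebraMap_apply] using this
  set K := IntermediateField.adjoin k (s : Set L) with hK
  have hTK : IntermediateField.adjoin k (Set.range T) = K := by
    refine le_antisymm (IntermediateField.adjoin_le_iff.2 ?_) (IntermediateField.adjoin_le_iff.2 ?_)
    · rintro _ ⟨i, rfl⟩
      simp only [T, IsScalarTower.algebraMap_apply R k L]
      exact mul_mem (K.algebraMap_mem _) (IntermediateField.subset_adjoin _ _ i.2)
    · intro z hz
      have hz' : z = algebraMap k L (algebraMap R k (c ⟨z, hz⟩))⁻¹ * T ⟨z, hz⟩ := by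
        simp only [T, IsScalarTower.algebraMap_apply R k L]
        rw [← mul_assoc, ← map_mul, inv_mul_cancel₀ (hc' _), map_one, one_mul]
      rw [hz']
      exact mul_mem (IntermediateField.algebraMap_mem _ _)
        (IntermediateField.subset_adjoin _ _ ⟨_, rfl⟩)
  have hTR : AlgebraicIndependent R T := hT.restrictScalars hinj
  let ev : MvPolynomial s R →+* L := (MvPolynomial.aeval T).toRingHom
  have hev : ∀ a : MvPolynomial s R,
      MvPolynomial.aeval T (MvPolynomial.map (algebraMap R k) a) = ev a := fun a =>
    MvPolynomial.aeval_map_algebraMap k T a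
  have hevK : ∀ a, ev a ∈ K := by
    intro a
    rw [← hev, ← hTK]
    exact IntermediateField.algebra_adjoin_le_adjoin _ _
      (by rw [Algebra.adjoin_range_eq_range_aeval]; exact ⟨_, rfl⟩)
  let _ : Algebra (MvPolynomial s R) L := ev.toAlgebra
  let _ : Algebra (MvPolynomial s R) K := (ev.codRestrict K hevK).toAlgebra
  have : IsScalarTower (MvPolynomial s R) K L := IsScalarTower.of_algebraMap_eq fun _ => rfl
  have hevK_inj : Function.Injective (algebraMap (MvPolynomial s R) K) := fun a b hab =>
    hTR (congrArg (algebraMap K L) hab)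
  have : FaithfulSMul (MvPolynomial s R) K := (faithfulSMul_iff_algebraMap_injective _ _).2 hevK_inj
  have : IsFractionRing (MvPolynomial s R) K := by
    refine IsFractionRing.of_field _ _ fun z => ?_
    obtain ⟨a, b, hab⟩ := (IntermediateField.mem_adjoin_range_iff k T z).1 (hTK.symm ▸ z.2)
    obtain ⟨e, he, a', ha'⟩ := exists_map_eq_C_mul (R := R) a
    obtain ⟨e', he', b', hb'⟩ := exists_map_eq_C_mul (R := R) b
    refine ⟨MvPolynomial.C e' * a', MvPolynomial.C e * b', Subtype.ext ?_⟩
    have hne : ∀ r : R, r ≠ 0 → algebraMap R L r ≠ 0 := fun r hr => by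
      rw [IsScalarTower.algebraMap_apply R k L]
      simpa using (map_ne_zero_iff _ hinj).2 hr
    change (z : L) = ev (MvPolynomial.C e' * a') / ev (MvPolynomial.C e * b')
    have hC : ∀ r : R, ev (MvPolynomial.C r) = algebraMap R L r := fun r =>
      MvPolynomial.aeval_C T r
    rw [map_mul, map_mul, hC, hC, ← hev a', ← hev b', ha', hb', map_mul, map_mul,
      MvPolynomial.aeval_C, MvPolynomial.aeval_C, hab, ← IsScalarTower.algebraMap_apply,
      ← IsScalarTower.algebraMap_apply, ← mul_assoc, ← mul_assoc, mul_comm (algebraMap R L e'),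
      mul_div_mul_left _ _ (mul_ne_zero (hne _ he) (hne _ he'))]
  have : Algebra.EssFiniteType K L := .of_comp k K L
  have : Module.Finite K L := Algebra.finite_of_essFiniteType_of_isAlgebraic
  obtain ⟨θ, hθ⟩ := Field.exists_primitive_element K L
  obtain ⟨r, hr, hrB⟩ := hB θ
  have hrK : algebraMap R L r = algebraMap K L (algebraMap k K (algebraMap R k r)) := by
    rw [← IsScalarTower.algebraMap_apply, ← IsScalarTower.algebraMap_apply]
  have htop : IntermediateField.adjoin K {algebraMap R L r * θ} = ⊤ := by
    rw [eq_top_iff, ← hθ, IntermediateField.adjoin_simple_le_iff]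
    have hθ' : θ = algebraMap K L (algebraMap k K (algebraMap R k r))⁻¹ *
        (algebraMap R L r * θ) := by
      have hr0 : algebraMap k K (algebraMap R k r) ≠ 0 := by
        simpa using (map_ne_zero_iff _ hinj).2 hr
      rw [hrK, ← mul_assoc, ← map_mul, inv_mul_cancel₀ hr0, map_one, one_mul]
    have hmem := mul_mem (IntermediateField.algebraMap_mem _
      (algebraMap k K (algebraMap R k r))⁻¹)
      (IntermediateField.mem_adjoin_simple_self K (algebraMap R L r * θ))
    rwa [← hθ'] at hmem
  obtain ⟨μ, q, g, h1, h2, h3, h4, h5⟩ := exists_polynomial_model_of_isSeparable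
    (P := MvPolynomial s R) (K := K) (Algebra.IsSeparable.isSeparable K (algebraMap R L r * θ)) x
    fun j => htop ▸ IntermediateField.mem_top
  exact ⟨T, algebraMap R L r * θ, hcB, hrB, hTR, μ, q, g, h1, h2, h3, h4, h5⟩

end HypersurfaceModel

section SeparableGeneration

open Polynomial

lemma exists_common_denominator {R k ι : Type*} [CommRing R] [IsDomain R] [Field k] [Algebra R k]
    [IsFractionRing R k] (s : Finset ι) (z : ι → k) : ∃ (b : R) (c : ι → R), b ≠ 0 ∧
      ∀ i ∈ s, algebraMap R k (c i) = algebraMap R k b * z i := by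
  obtain ⟨b, hb⟩ := IsLocalization.exist_integer_multiples (nonZeroDivisors R) s z
  choose! c hc using hb
  exact ⟨b, c, nonZeroDivisors.ne_zero b.2, fun i hi => by rw [hc i hi, Algebra.smul_def]⟩

/-- The condition, over a domain, that relations between `p`-th powers give relations between the
elements; over the fraction fields it is MacLane's criterion for separability. -/
def PowRelationsDescend (p : ℕ) (R : Type*) (B : Type*) [CommRing R] [CommRing B] [Algebra R B] :
    Prop :=
  ∀ (m : ℕ) (c : Fin m → R) (β : Fin m → B), c ≠ 0 → ∑ j, algebraMap R B (c j) * β j ^ p = 0 →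
    ∃ c' : Fin m → R, c' ≠ 0 ∧ ∑ j, algebraMap R B (c' j) * β j = 0

lemma PowRelationsDescend.exists_finset {p : ℕ} {R B ι : Type*} [CommRing R] [CommRing B]
    [Algebra R B] (h : PowRelationsDescend p R B) (s : Finset ι) (c : ι → R) (β : ι → B)
    (hc : ∃ i ∈ s, c i ≠ 0) (hsum : ∑ i ∈ s, algebraMap R B (c i) * β i ^ p = 0) :
    ∃ c' : ι → R, (∃ i ∈ s, c' i ≠ 0) ∧ ∑ i ∈ s, algebraMap R B (c' i) * β i = 0 := by
  classical
  have hreindex : ∀ f : ι → B, ∑ j, f (s.equivFin.symm j) = ∑ i ∈ s, f i := fun f => by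
    rw [← Finset.sum_coe_sort s, ← s.equivFin.symm.sum_comp]
  obtain ⟨i, hi, hci⟩ := hc
  obtain ⟨c', hc', hsum'⟩ := h _ (fun j => c (s.equivFin.symm j)) (fun j => β (s.equivFin.symm j))
    (fun h0 => hci (by simpa using congrFun h0 (s.equivFin ⟨i, hi⟩)))
    ((hreindex fun i => algebraMap R B (c i) * β i ^ p).trans hsum)
  obtain ⟨j, hj⟩ := Function.ne_iff.1 hc'
  refine ⟨fun i => if h : i ∈ s then c' (s.equivFin ⟨i, h⟩) else 0,
    ⟨_, (s.equivFin.symm j).2, by simpa using hj⟩, ?_⟩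
  rw [← hreindex, ← hsum']
  exact Finset.sum_congr rfl fun j _ => by simp

variable {R B k E : Type*} [CommRing R] [IsDomain R] [CommRing B] [IsDomain B] [Field k] [Field E]
  [Algebra R k] [IsFractionRing R k] [Algebra B E] [IsFractionRing B E] [Algebra R B]
  [Algebra k E] [Algebra R E] [IsScalarTower R k E] [IsScalarTower R B E]

lemma PowRelationsDescend.linearIndepOn_pow {p : ℕ} (h : PowRelationsDescend p R B)
    (L : IntermediateField k E) (s : Finset L) (hs : LinearIndepOn k id (s : Set L)) :
    LinearIndepOn k (· ^ p) (s : Set L) := by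
  rw [linearIndepOn_finset_iff] at hs ⊢
  intro z hz
  by_contra! hc
  obtain ⟨i, hi, hzi⟩ := hc
  obtain ⟨b, c, hb, hbc⟩ := exists_common_denominator (R := R) s z
  obtain ⟨γ, β, hγ, hγβ⟩ := exists_common_denominator (R := B) s fun i : L => (i : E)
  have hRk : Function.Injective (algebraMap R k) := IsFractionRing.injective R k
  have hBE : Function.Injective (algebraMap B E) := IsFractionRing.injective B E
  have hsmul : ∀ (r : k) (i : L), ((r • i : L) : E) = algebraMap k E r * i := fun r i =>
    Algebra.smul_def r (i : E)
  have hzE : ∑ i ∈ s, algebraMap k E (z i) * (i : E) ^ p = 0 := by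
    have := congrArg (algebraMap L E) hz
    rw [map_sum, map_zero] at this
    rw [← this]
    exact Finset.sum_congr rfl fun i _ => (hsmul (z i) (i ^ p)).symm
  have hsum : ∑ i ∈ s, algebraMap R B (c i) * β i ^ p = 0 := by
    apply hBE
    rw [map_sum, map_zero, ← mul_zero (algebraMap R E b * algebraMap B E γ ^ p), ← hzE,
      Finset.mul_sum]
    refine Finset.sum_congr rfl fun i hi => ?_
    rw [map_mul, map_pow, hγβ i hi, ← IsScalarTower.algebraMap_apply,
      IsScalarTower.algebraMap_apply R k E, hbc i hi, map_mul, ← IsScalarTower.algebraMap_apply]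
    ring
  obtain ⟨c', ⟨j, hj, hc'j⟩, hsum'⟩ := h.exists_finset s c β ⟨i, hi, fun h0 => by
    have := hbc i hi
    rw [h0, map_zero, eq_comm, mul_eq_zero] at this
    exact this.elim (fun h => hb ((map_eq_zero_iff _ hRk).1 h)) hzi⟩ hsum
  refine hc'j ((map_eq_zero_iff _ hRk).1 (hs (fun i => algebraMap R k (c' i)) ?_ j hj))
  apply (algebraMap L E).injective
  rw [map_zero, map_sum]
  apply mul_left_cancel₀ ((map_ne_zero_iff _ hBE).2 hγ)
  rw [mul_zero, ← map_zero (algebraMap B E), ← hsum', map_sum, Finset.mul_sum]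
  refine Finset.sum_congr rfl fun i hi => ?_
  rw [map_mul, hγβ i hi, ← IsScalarTower.algebraMap_apply, IsScalarTower.algebraMap_apply R k E]
  change _ * ((algebraMap R k (c' i) • i : L) : E) = _
  rw [hsmul]
  ring

end SeparableGeneration

section ModelInDomain

open Polynomial

universe u v

lemma exists_separating_transcendence_basis {R k E : Type*} [CommRing R] [Field k] [Field E]
    [Algebra R k] [FaithfulSMul R k] [Algebra k E] (hE : ∀ p : ℕ, p.Prime → CharP R p →
    ∀ (L : IntermediateField k E) (s : Finset L), LinearIndepOn k id (s : Set L) →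
      LinearIndepOn k (· ^ p) (s : Set L)) (L : IntermediateField k E)
    [Algebra.EssFiniteType k L] : ∃ s : Finset L, AlgebraicIndependent k ((↑) : s → L) ∧
      Algebra.IsSeparable (IntermediateField.adjoin k (s : Set L)) L := by
  obtain _ | ⟨p, hp, hpk⟩ := CharP.exists' k
  · obtain ⟨s, hs, hsep⟩ := exists_isTranscendenceBasis_and_isSeparable_of_perfectField k L
    exact ⟨s, hs.1, hsep⟩
  · have : ExpChar k p := .prime hp.out
    have hpR : CharP R p := (algebraMap R k).charP (FaithfulSMul.algebraMap_injective R k) p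
    obtain ⟨s, hs, hsep⟩ :=
      exists_isTranscendenceBasis_and_isSeparable_of_linearIndepOn_pow_of_essFiniteType p hp.out
        (hE p hp.out hpR L)
    exact ⟨s, hs.1, hsep⟩

/-- Finitely many elements of a domain `B`, whose fraction field is separable over that of `R`,
have a hypersurface model over `R` with generators in `B`. -/
lemma exists_hypersurface_model_of_powRelationsDescend {R : Type v} {B : Type u} [CommRing R]
    [IsDomain R] [CommRing B] [IsDomain B] [Algebra R B] [FaithfulSMul R B]
    (hdesc : ∀ p : ℕ, p.Prime → CharP R p → PowRelationsDescend p R B)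
    (hscale : ∀ β : B, β ≠ 0 → ∃ r : R, r ≠ 0 ∧ β ∣ algebraMap R B r)
    {κ : Type*} [Finite κ] (x : κ → B) :
    ∃ (σ : Type u) (T : σ → B) (θ : B), AlgebraicIndependent R T ∧
      ∃ (μ : (MvPolynomial σ R)[X]) (q : MvPolynomial σ R) (g : κ → (MvPolynomial σ R)[X]),
        eval₂ (MvPolynomial.aeval T).toRingHom θ μ = 0 ∧
        eval₂ (MvPolynomial.aeval T).toRingHom θ (derivative μ) ≠ 0 ∧ q ≠ 0 ∧
        (∀ j, eval₂ (MvPolynomial.aeval T).toRingHom θ (g j) = MvPolynomial.aeval T q * x j) ∧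
        ∀ h : (MvPolynomial σ R)[X], eval₂ (MvPolynomial.aeval T).toRingHom θ h = 0 →
          ∃ r ≠ 0, μ ∣ C r * h := by
  let k := FractionRing R
  let E := FractionRing B
  have hBE : Function.Injective (algebraMap B E) := IsFractionRing.injective B E
  have : FaithfulSMul R E := by
    rw [faithfulSMul_iff_algebraMap_injective, IsScalarTower.algebraMap_eq R B E]
    exact hBE.comp (FaithfulSMul.algebraMap_injective R B)
  let _ : Algebra k E := FractionRing.liftAlgebra R E
  have : IsScalarTower R k E := FractionRing.isScalarTower_liftAlgebra R E
  let L := IntermediateField.adjoin k (Set.range fun j => algebraMap B E (x j))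
  have : Algebra.EssFiniteType k L := IntermediateField.essFiniteType_iff.2
    (IntermediateField.fg_adjoin_of_finite (Set.finite_range _))
  have : IsScalarTower R L E := .of_algebraMap_eq fun _ => rfl
  obtain ⟨s, hs, hsep⟩ := exists_separating_transcendence_basis (R := R)
    (fun p hp hpR => (hdesc p hp hpR).linearIndepOn_pow) L
  have hxL : ∀ j, algebraMap B E (x j) ∈ L := fun j =>
    IntermediateField.subset_adjoin _ _ ⟨j, rfl⟩
  let B' : Subring L := (algebraMap B E).range.comap (algebraMap L E)
  have hB' : ∀ z : L, ∃ r : R, r ≠ 0 ∧ algebraMap R L r * z ∈ B' := by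
    intro z
    obtain ⟨a, b, hb, hab⟩ := IsFractionRing.div_surjective (A := B) (z : E)
    obtain ⟨r, hr, c, hc⟩ := hscale b (nonZeroDivisors.ne_zero hb)
    have hb' : algebraMap B E b ≠ 0 := (map_ne_zero_iff _ hBE).2 (nonZeroDivisors.ne_zero hb)
    refine ⟨r, hr, c * a, ?_⟩
    rw [map_mul, map_mul, ← IsScalarTower.algebraMap_apply R L E,
      IsScalarTower.algebraMap_apply R B E, hc, map_mul]
    change _ = _ * (z : E)
    rw [← hab, mul_comm (algebraMap B E b), mul_assoc, mul_div_cancel₀ _ hb']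
  obtain ⟨T, θ, hT, hθ, hTi, μ, q, g, h1, h2, h3, h4, h5⟩ :=
    exists_hypersurface_model (R := R) B' hB' s hs hsep fun j => ⟨_, hxL j⟩
  choose T' hT' using hT
  obtain ⟨θ', hθ'⟩ := hθ
  have hmv : ∀ a : MvPolynomial s R, algebraMap B E (MvPolynomial.aeval T' a) =
      algebraMap L E (MvPolynomial.aeval T a) := by
    intro a
    rw [← MvPolynomial.aeval_algebraMap_apply, ← MvPolynomial.aeval_algebraMap_apply]
    exact congrArg (fun t => MvPolynomial.aeval t a) (funext hT')
  have hev : ∀ h : (MvPolynomial s R)[X],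
      algebraMap B E (eval₂ (MvPolynomial.aeval T').toRingHom θ' h) =
        algebraMap L E (eval₂ (MvPolynomial.aeval T).toRingHom θ h) := by
    intro h
    rw [hom_eval₂, hom_eval₂, hθ']
    congr 1
    exact RingHom.ext hmv
  have hzero : ∀ h : (MvPolynomial s R)[X],
      eval₂ (MvPolynomial.aeval T').toRingHom θ' h = 0 ↔
        eval₂ (MvPolynomial.aeval T).toRingHom θ h = 0 := fun h => by
    rw [← map_eq_zero_iff _ hBE, hev, map_eq_zero_iff _ (algebraMap L E).injective]
  refine ⟨s, T', θ', fun a b hab => hTi ((algebraMap L E).injective ?_), μ, q, g,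
    (hzero _).2 h1, fun h => h2 ((hzero _).1 h), h3, fun j => hBE ?_, fun h hh =>
      h5 h ((hzero h).1 hh)⟩
  · rw [← hmv, ← hmv, hab]
  · rw [hev, h4, map_mul, map_mul, hmv]
    rfl

end ModelInDomain

section Specialization

open PowerSeries Filter

variable {F : Type*} [Field F]

noncomputable instance Ultrapower.algebraPowerSeries :
    Algebra (PowerSeries F) (PowerSeries (Ultrapower F)) :=
  (PowerSeries.map (Ultrapower.diag F)).toAlgebra

lemma Ultrapower.algebraMap_powerSeries (c : PowerSeries F) :
    algebraMap (PowerSeries F) (PowerSeries (Ultrapower F)) c =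
      PowerSeries.map (Ultrapower.diag F) c :=
  rfl

instance Ultrapower.faithfulSMul_powerSeries :
    FaithfulSMul (PowerSeries F) (PowerSeries (Ultrapower F)) :=
  (faithfulSMul_iff_algebraMap_injective _ _).2
    (PowerSeries.map_injective _ (Ultrapower.diag F).injective)

lemma Ultrapower.powRelationsDescend {p : ℕ} (hp : p.Prime) [CharP (PowerSeries F) p] :
    PowRelationsDescend p (PowerSeries F) (PowerSeries (Ultrapower F)) := by
  have : Fact p.Prime := ⟨hp⟩
  have : CharP F p := (PowerSeries.C (R := F)).charP PowerSeries.C_injective p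
  intro m c β hc h
  obtain ⟨j, hj⟩ := Function.ne_iff.1 hc
  obtain ⟨l, hl⟩ : ∃ l, coeff l (c j) ≠ 0 := by
    by_contra! h0
    exact hj (PowerSeries.ext fun l => by simpa using h0 l)
  obtain ⟨μ, hμ, hμl⟩ := exists_frobenius_inverse_linear (p := p) hl
  refine ⟨fun j => cartierOperator μ p (l % p) (c j), fun h0 => hμl ?_,
    sum_cartierOperator_mul_eq_zero hμ (Nat.mod_lt _ hp.pos) _ c β h⟩
  have := congrArg (coeff (l / p)) (congrFun h0 j)
  rwa [coeff_cartierOperator, Nat.div_add_mod, Pi.zero_apply, map_zero] at this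

lemma Ultrapower.exists_dvd_algebraMap {β : PowerSeries (Ultrapower F)} (hβ : β ≠ 0) :
    ∃ r : PowerSeries F, r ≠ 0 ∧ β ∣ algebraMap _ (PowerSeries (Ultrapower F)) r := by
  refine ⟨X ^ β.order.toNat, pow_ne_zero _ X_ne_zero, ?_⟩
  obtain ⟨u, hu⟩ := isUnit_divided_by_X_pow_order hβ
  refine ⟨↑u⁻¹, ?_⟩
  nth_rewrite 2 [← X_pow_order_mul_divXPowOrder (f := β)]
  rw [← hu, Units.mul_inv_cancel_right, Ultrapower.algebraMap_powerSeries, map_pow, map_X]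

lemma eval₂_mvPolynomial_aeval {R S σ τ : Type*} [CommRing R] [CommRing S] [Algebra R S]
    {φ : MvPolynomial σ R →+* S} (hφ : ∀ c, φ (MvPolynomial.C c) = algebraMap R S c) (θ : S)
    (g : τ → Polynomial (MvPolynomial σ R)) (f : MvPolynomial τ R) :
    (MvPolynomial.aeval g f).eval₂ φ θ = MvPolynomial.aeval (fun j => (g j).eval₂ φ θ) f := by
  induction f using MvPolynomial.induction_on with
  | C c =>
    rw [MvPolynomial.aeval_C, MvPolynomial.aeval_C, Polynomial.algebraMap_apply,
      MvPolynomial.algebraMap_eq, Polynomial.eval₂_C, hφ]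
  | add a b ha hb => rw [map_add, map_add, Polynomial.eval₂_add, ha, hb]
  | mul_X a i ha =>
    rw [map_mul, map_mul, Polynomial.eval₂_mul, ha, MvPolynomial.aeval_X, MvPolynomial.aeval_X]

lemma seqLimit_eval₂ {σ : Type*} (T : ℕ → σ → PowerSeries F) (θ : ℕ → PowerSeries F)
    (h : Polynomial (MvPolynomial σ (PowerSeries F))) :
    seqLimit F (fun N => h.eval₂ (MvPolynomial.eval (T N)) (θ N)) =
      h.eval₂ (MvPolynomial.aeval fun i => seqLimit F fun N => T N i).toRingHom (seqLimit F θ) := by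
  let ev : Polynomial (MvPolynomial σ (PowerSeries F)) →+* (ℕ → PowerSeries F) :=
    RingHom.pi fun N => Polynomial.eval₂RingHom (MvPolynomial.eval (T N)) (θ N)
  change ((seqLimit F).comp ev) h = Polynomial.eval₂RingHom _ _ h
  congr 1
  refine Polynomial.ringHom_ext' (MvPolynomial.ringHom_ext (fun c => ?_) fun i => ?_) ?_
  · change seqLimit F (fun N => Polynomial.eval₂ _ _ _) = Polynomial.eval₂ _ _ _
    simp [seqLimit_const, Ultrapower.algebraMap_powerSeries]
  · change seqLimit F (fun N => Polynomial.eval₂ _ _ _) = Polynomial.eval₂ _ _ _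
    simp
  · change seqLimit F (fun N => Polynomial.eval₂ _ _ _) = Polynomial.eval₂ _ _ _
    simp

/-- A nontrivial zero of a form over the ultrapower specializes to a nontrivial zero. -/
lemma exists_zero_of_ultrapower_zero {n d : ℕ} {f : MvPolynomial (Fin n) (PowerSeries F)}
    (hf : f.IsHomogeneous d) {x : Fin n → PowerSeries (Ultrapower F)} (hx : x ≠ 0)
    (hfx : MvPolynomial.aeval x f = 0) :
    ∃ y : Fin n → PowerSeries F, y ≠ 0 ∧ MvPolynomial.eval y f = 0 := by
  obtain ⟨σ, T, θ, hT, μ, q, g, hμ, hμ', hq, hg, hdvd⟩ :=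
    exists_hypersurface_model_of_powRelationsDescend
      (fun p hp _ => Ultrapower.powRelationsDescend (F := F) hp)
      (fun β hβ => Ultrapower.exists_dvd_algebraMap hβ) x
  choose T' hT' using fun i => seqLimit_surjective (T i)
  obtain ⟨θ', rfl⟩ := seqLimit_surjective θ
  obtain rfl : (fun i => seqLimit F (T' i)) = T := funext hT'
  let t : ℕ → σ → PowerSeries F := fun N i => T' i N
  have hlim := seqLimit_eval₂ t θ'
  obtain ⟨j, hj⟩ := Function.ne_iff.1 hx
  have hgj : (g j).eval₂ (MvPolynomial.aeval fun i => seqLimit F (T' i)).toRingHom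
      (seqLimit F θ') ≠ 0 := by
    rw [hg]
    exact mul_ne_zero ((map_ne_zero_iff _ hT).2 hq) hj
  obtain ⟨r, hr, w, hw⟩ := hdvd (MvPolynomial.aeval g f) (by
    rw [eval₂_mvPolynomial_aeval (fun c => MvPolynomial.aeval_C _ c)]
    simp only [hg]
    rw [aeval_const_mul_of_isHomogeneous hf, hfx, mul_zero])
  rw [← hlim] at hμ hμ' hgj
  have hrlim : seqLimit F (fun N => MvPolynomial.eval (t N) r) ≠ 0 := by
    have := hlim (Polynomial.C r)
    simp only [Polynomial.eval₂_C] at this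
    rw [this]
    exact (map_ne_zero_iff _ hT).2 hr
  obtain ⟨e₁, he₁⟩ := exists_eventually_not_X_pow_dvd_of_seqLimit_ne_zero hμ'
  obtain ⟨e₂, he₂⟩ := exists_eventually_not_X_pow_dvd_of_seqLimit_ne_zero hgj
  obtain ⟨e₃, he₃⟩ := exists_eventually_not_X_pow_dvd_of_seqLimit_ne_zero hrlim
  obtain ⟨N, hN, hN₁, hN₂, hN₃⟩ :=
    ((eventually_X_pow_dvd_of_seqLimit_eq_zero hμ (2 * (e₁ + e₂))).and
      (he₁.and (he₂.and he₃))).exists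
  rw [← Polynomial.eval_map] at hN hN₁ hN₂
  obtain ⟨b, hb, hbθ⟩ := exists_root_of_approximate_root (μ.map (MvPolynomial.eval (t N))) (θ' N)
    (e₁ + e₂) (fun h => hN₁ (by
      rw [Polynomial.derivative_map] at h
      exact (pow_dvd_pow _ (Nat.le_add_right _ _)).trans h)) hN
  refine ⟨fun j => ((g j).map (MvPolynomial.eval (t N))).eval b, fun h => hN₂ ?_, ?_⟩
  · have h1 := hbθ.trans (((g j).map (MvPolynomial.eval (t N))).sub_dvd_eval_sub b (θ' N))
    rw [show ((g j).map (MvPolynomial.eval (t N))).eval b = 0 from congrFun h j, zero_sub,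
      dvd_neg] at h1
    exact (pow_dvd_pow _ (Nat.le_add_left _ _)).trans h1
  · have h1 := congrArg (Polynomial.eval₂ (MvPolynomial.eval (t N)) b) hw
    rw [Polynomial.eval₂_mul, Polynomial.eval₂_mul, ← Polynomial.eval_map _ b (p := μ), hb,
      zero_mul, Polynomial.eval₂_C, mul_eq_zero] at h1
    have h2 := h1.resolve_left fun h => hN₃ (h ▸ dvd_zero _)
    rw [eval₂_mvPolynomial_aeval (fun c => MvPolynomial.eval_C c), MvPolynomial.aeval_eq_eval] at h2
    simpa only [Polynomial.eval_map] using h2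

end Specialization

/-- **Greenberg**: if `F` is a `C_i` field, then the field `F((t))` of formal Laurent series
over `F` is a `C_{i+1}` field. -/
theorem greenberg (i : ℕ) (F : Type*) [Field F] (hF : IsCField i F) :
    IsCField (i + 1) (LaurentSeries F) := by
  intro n d hd hn φ hφ
  obtain ⟨c, hc, f, hf⟩ := exists_map_eq_C_mul (R := PowerSeries F) φ
  have hinj : Function.Injective (algebraMap (PowerSeries F) (LaurentSeries F)) :=
    IsFractionRing.injective _ _
  have hc' : algebraMap (PowerSeries F) (LaurentSeries F) c ≠ 0 := (map_ne_zero_iff _ hinj).2 hc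
  have hfhom : f.IsHomogeneous d := by
    refine MvPolynomial.IsHomogeneous.of_map hinj ?_
    rw [hf]
    exact hφ.C_mul _
  choose w hw hwf using hF.exists_approximate_zero hd hn f hfhom
  let x : Fin n → PowerSeries (Ultrapower F) := fun j => seqLimit F fun N => w N j
  have hx : x ≠ 0 := by
    intro h0
    have : ∀ᶠ N in Filter.hyperfilter ℕ, ∀ j, PowerSeries.coeff 0 (w N j) = 0 :=
      Filter.eventually_all.2 fun j => coeff_seqLimit_eq_zero_iff.1
        ((congrArg (PowerSeries.coeff 0) (congrFun h0 j)).trans (map_zero _))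
    obtain ⟨N, hN⟩ := this.exists
    obtain ⟨j, hj⟩ := hw N
    exact hj (by simpa using hN j)
  have hfx : MvPolynomial.aeval x f = 0 := by
    have h := seqLimit_eval₂ w 0 (Polynomial.C f)
    simp only [Polynomial.eval₂_C] at h
    exact h.symm.trans (seqLimit_eq_zero_of_X_pow_dvd hwf)
  obtain ⟨y, hy, hfy⟩ := exists_zero_of_ultrapower_zero hfhom hx hfx
  refine ⟨fun j => algebraMap _ _ (y j), fun h0 => hy (funext fun j => hinj ?_), ?_⟩
  · rw [Pi.zero_apply, map_zero]
    exact congrFun h0 j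
  · have h0 : MvPolynomial.aeval (fun j => algebraMap _ (LaurentSeries F) (y j)) f = 0 :=
      (MvPolynomial.aeval_algebraMap_apply _ y f).trans
        (by rw [MvPolynomial.aeval_eq_eval, hfy, map_zero])
    have h1 := congrArg (MvPolynomial.eval fun j => algebraMap _ (LaurentSeries F) (y j)) hf
    rw [map_mul, MvPolynomial.eval_C, MvPolynomial.eval_map, ← MvPolynomial.aeval_def, h0,
      eq_comm, mul_eq_zero] at h1
    exact h1.resolve_left hc'
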